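/- Let d be a positive integer and f ∈ S̃_d. Then the function y ↦ |y|^{(d−1)/2} f(y) is smooth on the right and on the left at y = 0: its restriction to (0,∞) extends to a smooth function on [0,∞), and its restriction to (−∞,0) extends to a smooth function on (−∞,0]. -/

import Mathlib

open MeasureTheory Set

/-- Membership in the space `I_d`: `φ` is smooth on `ℝ` and the function
`x ↦ x^{-d-1} φ(-1/x)` (defined for `x ≠ 0`) extends to a smooth function on `ℝ`. -/
def MemI (d : ℕ) (φ : ℝ → ℂ) : Prop :=
  ContDiff ℝ (⊤ : ℕ∞) φ ∧
    ∃ ψ : ℝ → ℂ, ContDiff ℝ (⊤ : ℕ∞) ψ ∧ ∀ x : ℝ, x ≠ 0 → ψ x = ((x : ℂ) ^ (d + 1))⁻¹ * φ (-1 / x)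

/-- The normalized Fourier transform `φ̂(y) = (2π)^{-1/2} ∫_ℝ φ(x) e^{-ixy} dx`. -/
noncomputable def fourierHat (φ : ℝ → ℂ) (y : ℝ) : ℂ :=
  (((2 * Real.pi) ^ (-(1 : ℝ) / 2) : ℝ) : ℂ) * ∫ x : ℝ, φ x * Complex.exp (-(Complex.I * x * y))

/-- The operator `M_d(φ)(y) = |y|^{(1-d)/2} φ̂(y)`. -/
noncomputable def Md (d : ℕ) (φ : ℝ → ℂ) (y : ℝ) : ℂ :=
  ((|y| ^ ((1 - (d : ℝ)) / 2) : ℝ) : ℂ) * fourierHat φ y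

/-- Membership in `S̃_d = M_d(I_d)`, viewed as functions on `ℝ ∖ {0}`:
`f` agrees with `M_d(φ)` away from `0` for some `φ ∈ I_d`. -/
def MemStilde (d : ℕ) (f : ℝ → ℂ) : Prop :=
  ∃ φ : ℝ → ℂ, MemI d φ ∧ ∀ y : ℝ, y ≠ 0 → f y = Md d φ y

theorem hasDerivAt_max_zero_pow (n : ℕ) (x : ℝ) :
    HasDerivAt (fun y : ℝ => max y 0 ^ (n + 2)) ((n + 2) * max x 0 ^ (n + 1)) x := by
  rcases lt_trichotomy x 0 with hx | rfl | hx
  · have h : (fun y : ℝ => max y 0 ^ (n + 2)) =ᶠ[nhds x] fun _ => 0 := by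
      filter_upwards [Iio_mem_nhds hx] with y hy
      simp [max_eq_right (mem_Iio.1 hy).le]
    simpa [max_eq_right hx.le] using (hasDerivAt_const x (0 : ℝ)).congr_of_eventuallyEq h
  · rw [hasDerivAt_iff_isLittleO_nhds_zero]
    have h : (fun h : ℝ => max h 0 ^ (n + 2)) =O[nhds 0] fun h : ℝ => h ^ (n + 2) := by
      refine Asymptotics.isBigO_norm_right.1 <|
        Asymptotics.IsBigO.of_norm_le (g := fun h : ℝ => ‖h ^ (n + 2)‖) (fun h => ?_)
      rw [norm_pow, norm_pow]
      gcongr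
      rw [Real.norm_eq_abs, Real.norm_eq_abs, abs_of_nonneg (le_max_right h 0)]
      exact max_le (le_abs_self h) (abs_nonneg h)
    have h2 : (fun h : ℝ => h ^ (n + 2)) =o[nhds 0] fun h : ℝ => h := by
      simpa using Asymptotics.isLittleO_pow_pow (𝕜 := ℝ) (show 1 < n + 2 by omega)
    simpa using h.trans_isLittleO h2
  · have h : (fun y : ℝ => max y 0 ^ (n + 2)) =ᶠ[nhds x] fun y => y ^ (n + 2) := by
      filter_upwards [Ioi_mem_nhds hx] with y hy
      rw [max_eq_left (mem_Ioi.1 hy).le]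
    have := (hasDerivAt_pow (n + 2) x).congr_of_eventuallyEq h
    rw [max_eq_left hx.le]
    have hc : ((n : ℝ) + 2) * x ^ (n + 1) = ((n + 2 : ℕ) : ℝ) * x ^ (n + 2 - 1) := by
      push_cast
      rfl
    rwa [hc]

theorem contDiff_max_zero_pow (n : ℕ) : ContDiff ℝ n fun y : ℝ => max y 0 ^ (n + 1) := by
  induction n with
  | zero => exact contDiff_zero.2 (by fun_prop)
  | succ n ih =>
    push_cast
    refine contDiff_succ_iff_deriv.2
      ⟨fun x => (hasDerivAt_max_zero_pow n x).differentiableAt, by simp, ?_⟩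
    rw [funext fun x => (hasDerivAt_max_zero_pow n x).deriv]
    exact contDiff_const.mul ih

theorem contDiffAt_max_zero_pow {x : ℝ} (hx : x ≠ 0) (m : ℕ) (hm : m ≠ 0) :
    ContDiffAt ℝ (⊤ : ℕ∞) (fun y : ℝ => max y 0 ^ m) x := by
  rcases lt_or_gt_of_ne hx with hx | hx
  · refine (contDiffAt_const (c := (0 : ℝ))).congr_of_eventuallyEq ?_
    filter_upwards [Iio_mem_nhds hx] with y hy
    simp [max_eq_right (mem_Iio.1 hy).le, hm]
  · refine (contDiffAt_id.pow m).congr_of_eventuallyEq ?_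
    filter_upwards [Ioi_mem_nhds hx] with y hy
    simp [max_eq_left (mem_Ioi.1 hy).le]

/-- A smooth cutoff function equal to `1` on `[-1, 1]`. -/
noncomputable def cutoff : ContDiffBump (0 : ℝ) := ⟨1, 2, one_pos, one_lt_two⟩

/-- The truncated power `y ↦ max (-y) 0 ^ m` multiplied by a cutoff function. -/
noncomputable def cutoffPow (m : ℕ) (y : ℝ) : ℂ := ((cutoff y * max (-y) 0 ^ m : ℝ) : ℂ)

theorem contDiff_cutoffPow {n m : ℕ} (h : n < m) : ContDiff ℝ n (cutoffPow m) := by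
  obtain ⟨k, rfl⟩ : ∃ k, m = k + 1 := ⟨m - 1, by omega⟩
  refine Complex.ofRealCLM.contDiff.comp ((cutoff.contDiff).mul ?_)
  exact ((contDiff_max_zero_pow k).comp contDiff_neg).of_le (by exact_mod_cast Nat.lt_succ_iff.1 h)

theorem hasCompactSupport_cutoffPow (m : ℕ) : HasCompactSupport (cutoffPow m) := by
  have : HasCompactSupport fun y => cutoff y * max (-y) 0 ^ m :=
    cutoff.hasCompactSupport.mul_right
  exact this.comp_left (g := ((↑) : ℝ → ℂ)) Complex.ofReal_zero

theorem exists_bound_iteratedDeriv_cutoffPow (m : ℕ) :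
    ∃ B : ℝ, 0 ≤ B ∧ ∀ k < m, ∀ y, ‖iteratedDeriv k (cutoffPow m) y‖ ≤ B := by
  have h : ∀ k : ℕ, ∃ B : ℝ, k < m → ∀ y, ‖iteratedDeriv k (cutoffPow m) y‖ ≤ B := by
    intro k
    by_cases hk : k < m
    · obtain ⟨B, hB⟩ := ((hasCompactSupport_cutoffPow m).iteratedFDeriv (𝕜 := ℝ)
        k).exists_bound_of_continuous ((contDiff_cutoffPow hk).continuous_iteratedFDeriv le_rfl)
      refine ⟨B, fun _ y => ?_⟩
      rw [← norm_iteratedFDeriv_eq_norm_iteratedDeriv]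
      exact hB y
    · exact ⟨0, fun h => absurd h hk⟩
  choose B hB using h
  refine ⟨∑ k ∈ Finset.range m, |B k|, by positivity, fun k hk y => ?_⟩
  exact (hB k hk y).trans ((le_abs_self _).trans
    (Finset.single_le_sum (f := fun k => |B k|) (fun _ _ => abs_nonneg _) (Finset.mem_range.2 hk)))

theorem exists_scale_bound (m : ℕ) (a : ℂ) {ε : ℝ} (hε : 0 < ε) :
    ∃ l : ℝ, 0 < l ∧ ∀ k < m, ∀ y,
      ‖iteratedFDeriv ℝ k (fun y : ℝ => (a * ((l : ℂ) ^ m)⁻¹) • cutoffPow m (l * y)) y‖ ≤ ε := by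
  obtain ⟨B, hB0, hB⟩ := exists_bound_iteratedDeriv_cutoffPow m
  set l : ℝ := 1 + ‖a‖ * B / ε with hl
  have hl1 : 1 ≤ l := by
    have : 0 ≤ ‖a‖ * B / ε := by positivity
    linarith
  have hl0 : 0 < l := by linarith
  refine ⟨l, hl0, fun k hk y => ?_⟩
  rw [norm_iteratedFDeriv_eq_norm_iteratedDeriv,
    iteratedDeriv_fun_const_smul_field, iteratedDeriv_comp_const_smul (contDiff_cutoffPow hk)]
  simp only [norm_smul, norm_mul, norm_inv, norm_pow, Complex.norm_real, Real.norm_eq_abs,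
    abs_of_pos hl0]
  have h1 : (l ^ m)⁻¹ * l ^ k ≤ l⁻¹ := by
    rw [← div_eq_inv_mul, div_le_iff₀ (by positivity), ← div_eq_inv_mul, le_div_iff₀ hl0, ← pow_succ]
    exact pow_le_pow_right₀ hl1 hk
  calc ‖a‖ * (l ^ m)⁻¹ * (l ^ k * ‖iteratedDeriv k (cutoffPow m) (l * y)‖)
      = ‖a‖ * ((l ^ m)⁻¹ * l ^ k) * ‖iteratedDeriv k (cutoffPow m) (l * y)‖ := by ring
    _ ≤ ‖a‖ * l⁻¹ * B := by gcongr; exact hB k hk _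
    _ = ‖a‖ * B / l := by ring
    _ ≤ ε := by
      rw [div_le_iff₀ hl0, hl, mul_add, mul_div_cancel₀ _ hε.ne']
      linarith

theorem scaled_cutoffPow {l : ℝ} (hl : 0 < l) (a : ℂ) (m : ℕ) (y : ℝ) :
    (a * ((l : ℂ) ^ m)⁻¹) • cutoffPow m (l * y) =
      a * ((cutoff (l * y) * max (-y) 0 ^ m : ℝ) : ℂ) := by
  have h : max (-(l * y)) 0 = l * max (-y) 0 := by
    rw [mul_max_of_nonneg _ _ hl.le, mul_zero, mul_neg]
  have hl' : (l : ℂ) ≠ 0 := by exact_mod_cast hl.ne'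
  rw [cutoffPow, h, mul_pow, smul_eq_mul]
  push_cast
  field_simp

theorem contDiff_truncated_sub_scaled {l : ℝ} (hl : 0 < l) (a : ℂ) {m : ℕ} (hm : m ≠ 0) :
    ContDiff ℝ (⊤ : ℕ∞) fun y : ℝ =>
      a * ((max (-y) 0 ^ m : ℝ) : ℂ) - (a * ((l : ℂ) ^ m)⁻¹) • cutoffPow m (l * y) := by
  have key : ContDiff ℝ (⊤ : ℕ∞) fun y : ℝ => (1 - cutoff (l * y)) * max (-y) 0 ^ m := by
    rw [contDiff_iff_contDiffAt]
    intro y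
    by_cases hy : y = 0
    · subst hy
      refine (contDiffAt_const (c := (0 : ℝ))).congr_of_eventuallyEq ?_
      have : (fun y : ℝ => l * y) ⁻¹' Metric.closedBall 0 1 ∈ nhds 0 := by
        refine ContinuousAt.preimage_mem_nhds (by fun_prop) ?_
        rw [mul_zero]
        exact Metric.closedBall_mem_nhds _ one_pos
      filter_upwards [this] with y hy
      rw [cutoff.one_of_mem_closedBall hy]
      simp
    · refine ContDiffAt.mul (contDiffAt_const.sub ?_) ?_
      · exact (cutoff.contDiff.comp (contDiff_const.mul contDiff_id)).contDiffAt
      · exact (contDiffAt_max_zero_pow (neg_ne_zero.2 hy) m hm).comp y contDiff_neg.contDiffAt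
  have key' : ContDiff ℝ (⊤ : ℕ∞) fun y : ℝ =>
      a * (((1 - cutoff (l * y)) * max (-y) 0 ^ m : ℝ) : ℂ) :=
    contDiff_const.mul (Complex.ofRealCLM.contDiff.comp key)
  convert key' using 2 with y
  rw [scaled_cutoffPow hl]
  push_cast
  ring

/-- A Borel-type gluing lemma: if `G 0` can be corrected by truncated powers supported in
`(-∞, 0]` into functions `G n` of class `C^n` for every `n`, then its restriction to `(0, ∞)`
extends to a smooth function. -/
theorem exists_contDiff_of_truncated_pow {d : ℕ} (hd : 0 < d) (G : ℕ → ℝ → ℂ) (a : ℕ → ℂ)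
    (hG : ∀ n : ℕ, ContDiff ℝ n (G n))
    (h : ∀ n y, G n y = G (n + 1) y + a n * ((max (-y) 0 ^ (d + n) : ℝ) : ℂ)) :
    ∃ g : ℝ → ℂ, ContDiff ℝ (⊤ : ℕ∞) g ∧ ∀ y, 0 < y → g y = G 0 y := by
  choose l hl0 hl using fun n : ℕ =>
    exists_scale_bound (d + n) (a n) (ε := (1 / 2 : ℝ) ^ n) (by positivity)
  set E : ℕ → ℝ → ℂ := fun n y =>
    (a n * ((l n : ℂ) ^ (d + n))⁻¹) • cutoffPow (d + n) (l n * y) with hE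
  have hEcd : ∀ n : ℕ, ContDiff ℝ n (E n) := fun n =>
    ((contDiff_cutoffPow (show n < d + n by omega)).comp
      (contDiff_const.mul contDiff_id)).const_smul (a n * ((l n : ℂ) ^ (d + n))⁻¹)
  have hsum : ∀ y, Summable fun n => E n y := fun y => by
    refine Summable.of_norm_bounded summable_geometric_two fun n => ?_
    have := hl n 0 (by omega) y
    rwa [norm_iteratedFDeriv_zero] at this
  have hGn : ∀ M y, G 0 y = G M y +
      ∑ n ∈ Finset.range M, a n * ((max (-y) 0 ^ (d + n) : ℝ) : ℂ) := by
    intro M y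
    induction M with
    | zero => simp
    | succ M ih => rw [ih, h M, Finset.sum_range_succ]; ring
  refine ⟨fun y => G 0 y - ∑' n, E n y, ?_, fun y hy => ?_⟩
  · rw [contDiff_infty]
    intro M
    have htail : ContDiff ℝ M fun y => ∑' n, E (n + M) y := by
      refine contDiff_tsum (N := (M : ℕ∞)) (v := fun _ n => (1 / 2 : ℝ) ^ (n + M))
        (fun n => (hEcd (n + M)).of_le (by exact_mod_cast Nat.le_add_left M n))
        (fun _ _ => (summable_nat_add_iff M).2 summable_geometric_two) fun k n y hk => ?_
      have hk : k ≤ M := by exact_mod_cast hk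
      exact hl (n + M) k (by omega) y
    have hfin : ContDiff ℝ M fun y => ∑ n ∈ Finset.range M,
        (a n * ((max (-y) 0 ^ (d + n) : ℝ) : ℂ) - E n y) :=
      ContDiff.sum fun n _ => (contDiff_infty.1
        (contDiff_truncated_sub_scaled (hl0 n) (a n) (show d + n ≠ 0 by omega))) M
    convert ((hG M).add hfin).sub htail using 2 with y
    rw [hGn M y, ← (hsum y).sum_add_tsum_nat_add M, Finset.sum_sub_distrib]
    ring
  · have : ∀ n, E n y = 0 := fun n => by
      simp only [hE]
      rw [scaled_cutoffPow (hl0 n), max_eq_right (by linarith), zero_pow (by omega)]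
      simp
    simp [this]

theorem hasDerivAt_integral_pow_smul_comp_mul (k : ℕ) {f : ℝ → ℂ} (hf : ContDiff ℝ 1 f) (u : ℝ) :
    HasDerivAt (fun u : ℝ => ∫ t in (0 : ℝ)..1, t ^ k • f (t * u))
      (∫ t in (0 : ℝ)..1, t ^ (k + 1) • deriv f (t * u)) u := by
  have hf' : Continuous (deriv f) := hf.continuous_deriv le_rfl
  have hfc : Continuous f := hf.continuous
  obtain ⟨C, hC⟩ := (isCompact_Icc (a := -(|u| + 1)) (b := |u| + 1)).exists_bound_of_continuousOn
    hf'.continuousOn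
  refine (intervalIntegral.hasDerivAt_integral_of_dominated_loc_of_deriv_le
    (F := fun (u t : ℝ) => t ^ k • f (t * u)) (F' := fun (u t : ℝ) => t ^ (k + 1) • deriv f (t * u))
    (bound := fun _ => C) (Metric.ball_mem_nhds u one_pos) ?_ ?_ ?_ ?_ ?_ ?_).2
  · exact Filter.Eventually.of_forall fun v =>
      (show Continuous fun t : ℝ => t ^ k • f (t * v) by fun_prop).aestronglyMeasurable
  · exact (show Continuous fun t : ℝ => t ^ k • f (t * u) by fun_prop).intervalIntegrable _ _
  · exact (show Continuous fun t : ℝ => t ^ (k + 1) • deriv f (t * u) by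
      fun_prop).aestronglyMeasurable
  · refine Filter.Eventually.of_forall fun t ht v hv => ?_
    rw [uIoc_of_le zero_le_one] at ht
    have hv' : |v| ≤ |u| + 1 := by
      have h1 : |v - u| < 1 := hv
      have h2 := abs_sub_abs_le_abs_sub v u
      linarith
    have htv : |t * v| ≤ |u| + 1 := by
      rw [abs_mul, abs_of_pos ht.1]
      exact (mul_le_of_le_one_left (abs_nonneg v) ht.2).trans hv'
    rw [norm_smul, norm_pow, Real.norm_eq_abs, abs_of_pos ht.1]
    exact (mul_le_of_le_one_left (norm_nonneg _) (pow_le_one₀ ht.1.le ht.2)).trans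
      (hC _ (abs_le.1 htv))
  · exact intervalIntegrable_const
  · refine Filter.Eventually.of_forall fun t _ v _ => ?_
    have h1 : HasDerivAt (fun v : ℝ => t * v) t v := by simpa using (hasDerivAt_id v).const_mul t
    have h2 := (hf.differentiable one_ne_zero (t * v)).hasDerivAt.scomp v h1
    have h3 := h2.const_smul (t ^ k)
    rw [smul_smul, ← pow_succ] at h3
    exact h3

theorem contDiff_integral_pow_smul_comp_mul (n k : ℕ) {f : ℝ → ℂ}
    (hf : ContDiff ℝ (⊤ : ℕ∞) f) :
    ContDiff ℝ n fun u : ℝ => ∫ t in (0 : ℝ)..1, t ^ k • f (t * u) := by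
  have hd := fun (k : ℕ) {f : ℝ → ℂ} (hf : ContDiff ℝ (⊤ : ℕ∞) f) =>
    hasDerivAt_integral_pow_smul_comp_mul k (hf.of_le (by exact_mod_cast le_top) : ContDiff ℝ 1 f)
  induction n generalizing k f with
  | zero =>
    exact contDiff_zero.2 (continuous_iff_continuousAt.2 fun u => (hd k hf u).continuousAt)
  | succ n ih =>
    push_cast
    refine contDiff_succ_iff_deriv.2 ⟨fun u => (hd k hf u).differentiableAt, by simp, ?_⟩
    rw [funext fun u => (hd k hf u).deriv]
    exact ih (k + 1) (contDiff_infty_iff_deriv.1 hf).2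

/-- Hadamard's lemma on the line: a smooth function vanishing at `0` is divisible by `u`. -/
theorem exists_contDiff_eq_mul {R : ℝ → ℂ} (hR : ContDiff ℝ (⊤ : ℕ∞) R) (h0 : R 0 = 0) :
    ∃ S : ℝ → ℂ, ContDiff ℝ (⊤ : ℕ∞) S ∧ ∀ u : ℝ, R u = u * S u := by
  refine ⟨fun u => ∫ t in (0 : ℝ)..1, t ^ 0 • deriv R (t * u), contDiff_infty.2 fun n =>
    contDiff_integral_pow_smul_comp_mul n 0 (contDiff_infty_iff_deriv.1 hR).2, fun u => ?_⟩
  have hR' : Continuous (deriv R) := (contDiff_infty_iff_deriv.1 hR).2.continuous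
  have h : ∀ t : ℝ, HasDerivAt (fun t : ℝ => R (t * u)) (u • deriv R (t * u)) t := fun t => by
    have h1 : HasDerivAt (fun t : ℝ => t * u) u t := by simpa using (hasDerivAt_id t).mul_const u
    exact ((contDiff_infty_iff_deriv.1 hR).1 (t * u)).hasDerivAt.scomp t h1
  have := intervalIntegral.integral_eq_sub_of_hasDerivAt (a := 0) (b := 1) (fun t _ => h t)
    ((show Continuous fun t : ℝ => u • deriv R (t * u) by fun_prop).intervalIntegrable _ _)
  rw [intervalIntegral.integral_smul] at this
  rw [one_mul, zero_mul, h0, sub_zero] at this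
  simp only [pow_zero, one_smul]
  rw [← this, Complex.real_smul]

theorem one_add_I_mul_ne_zero (x : ℝ) : (1 + Complex.I * x : ℂ) ≠ 0 := fun h => by
  simpa using congrArg Complex.re h

theorem sub_I_ne_zero (u : ℝ) : (u - Complex.I : ℂ) ≠ 0 := fun h => by
  simpa using congrArg Complex.im h

/-- The rational function `x ↦ (1 + i x)^{-m-1}`, a model element of `I_m`. -/
noncomputable def ratPow (m : ℕ) (x : ℝ) : ℂ := ((1 + Complex.I * x) ^ (m + 1))⁻¹

theorem contDiff_inv_sub_I_pow (m : ℕ) :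
    ContDiff ℝ (⊤ : ℕ∞) fun u : ℝ => ((u - Complex.I : ℂ) ^ m)⁻¹ :=
  ((Complex.ofRealCLM.contDiff.sub contDiff_const).pow m).inv fun u => pow_ne_zero _ (sub_I_ne_zero u)

theorem contDiff_ratPow (m : ℕ) : ContDiff ℝ (⊤ : ℕ∞) (ratPow m) :=
  ((contDiff_const.add (contDiff_const.mul Complex.ofRealCLM.contDiff)).pow (m + 1)).inv
    fun x => pow_ne_zero _ (one_add_I_mul_ne_zero x)

theorem inv_pow_mul_ratPow_neg_inv (m : ℕ) {u : ℝ} (hu : u ≠ 0) :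
    ((u : ℂ) ^ (m + 1))⁻¹ * ratPow m (-1 / u) = ((u - Complex.I : ℂ) ^ (m + 1))⁻¹ := by
  have hu' : (u : ℂ) ≠ 0 := by exact_mod_cast hu
  rw [ratPow, ← mul_inv, ← mul_pow]
  congr 2
  push_cast
  field_simp
  ring

theorem memI_ratPow (m : ℕ) : MemI m (ratPow m) :=
  ⟨contDiff_ratPow m, _, contDiff_inv_sub_I_pow (m + 1),
    fun _ hx => (inv_pow_mul_ratPow_neg_inv m hx).symm⟩

/-- Subtracting a multiple of the model function improves the decay at infinity by one order. -/
theorem MemI.exists_sub_ratPow {d : ℕ} {φ : ℝ → ℂ} (h : MemI d φ) :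
    ∃ c : ℂ, MemI (d + 1) fun x => φ x - c * ratPow d x := by
  obtain ⟨hφ, ψ, hψ, hψφ⟩ := h
  set c : ℂ := ψ 0 * (-Complex.I) ^ (d + 1) with hc
  obtain ⟨S, hS, hRS⟩ := exists_contDiff_eq_mul
    (R := fun u => ψ u - c * ((u - Complex.I : ℂ) ^ (d + 1))⁻¹)
    (hψ.sub (contDiff_const.mul (contDiff_inv_sub_I_pow (d + 1)))) (by
      have : (-Complex.I) ^ (d + 1) ≠ 0 := pow_ne_zero _ (neg_ne_zero.2 Complex.I_ne_zero)
      simp only [hc, Complex.ofReal_zero, zero_sub]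
      rw [mul_assoc, mul_inv_cancel₀ this, mul_one, sub_self])
  refine ⟨c, hφ.sub (contDiff_const.mul (contDiff_ratPow d)), S, hS, fun x hx => ?_⟩
  have hx' : (x : ℂ) ≠ 0 := by exact_mod_cast hx
  have := hRS x
  simp only [hψφ x hx, ← inv_pow_mul_ratPow_neg_inv d hx] at this
  rw [eq_comm, pow_succ, mul_inv]
  field_simp at this ⊢
  linear_combination this

theorem MemI.comp_neg {d : ℕ} {φ : ℝ → ℂ} (h : MemI d φ) : MemI d fun x => φ (-x) := by
  obtain ⟨hφ, ψ, hψ, hψφ⟩ := h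
  refine ⟨hφ.comp contDiff_neg, fun x => (-1) ^ (d + 1) * ψ (-x),
    contDiff_const.mul (hψ.comp contDiff_neg), fun x hx => ?_⟩
  have h1 : ((-1 : ℂ) ^ (d + 1)) ≠ 0 := pow_ne_zero _ (neg_ne_zero.2 one_ne_zero)
  beta_reduce
  rw [hψφ (-x) (neg_ne_zero.2 hx), Complex.ofReal_neg, neg_pow (x : ℂ), mul_inv,
    ← mul_assoc, ← mul_assoc, mul_inv_cancel₀ h1, one_mul, div_neg, neg_div]

theorem MemI.exists_bound {d : ℕ} {φ : ℝ → ℂ} (h : MemI d φ) :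
    ∃ C : ℝ, ∀ n < d, ∀ x : ℝ, ‖x‖ ^ n * ‖φ x‖ ≤ C * (1 + x ^ 2)⁻¹ := by
  obtain ⟨hφ, ψ, hψ, hψφ⟩ := h
  obtain ⟨A, hA⟩ := (isCompact_Icc (a := (-1 : ℝ)) (b := 1)).exists_bound_of_continuousOn
    hφ.continuous.continuousOn
  obtain ⟨B, hB⟩ := (isCompact_Icc (a := (-1 : ℝ)) (b := 1)).exists_bound_of_continuousOn
    hψ.continuous.continuousOn
  have hA0 : 0 ≤ A := (norm_nonneg _).trans (hA 0 (by simp))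
  have hB0 : 0 ≤ B := (norm_nonneg _).trans (hB 0 (by simp))
  refine ⟨2 * (A + B), fun n hn x => ?_⟩
  rw [← div_eq_mul_inv, le_div_iff₀ (by positivity)]
  rcases le_or_gt |x| 1 with hx | hx
  · have h1 : ‖x‖ ^ n ≤ 1 := pow_le_one₀ (norm_nonneg x) hx
    have h2 : ‖φ x‖ ≤ A := hA x (abs_le.1 hx)
    have h3 : x ^ 2 ≤ 1 := by rw [← sq_abs]; exact pow_le_one₀ (abs_nonneg x) hx
    calc ‖x‖ ^ n * ‖φ x‖ * (1 + x ^ 2) ≤ 1 * A * (1 + 1) := by gcongr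
      _ ≤ 2 * (A + B) := by linarith
  · have hx0 : x ≠ 0 := fun h => by simp [h] at hx; linarith
    have habs : 0 < |x| := abs_pos.2 hx0
    have hu : -1 / x ≠ 0 := div_ne_zero (by norm_num) hx0
    have hinv : -1 / (-1 / x) = x := by field_simp
    have h1 := hψφ (-1 / x) hu
    rw [hinv] at h1
    have h2 : ‖ψ (-1 / x)‖ ≤ B := hB _ (abs_le.1 (by
      rw [abs_div, abs_neg, abs_one]
      exact div_le_one_of_le₀ hx.le (abs_nonneg x)))
    have h3 : ‖ψ (-1 / x)‖ = |x| ^ (d + 1) * ‖φ x‖ := by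
      rw [h1, norm_mul, norm_inv, norm_pow, Complex.norm_real, Real.norm_eq_abs, abs_div, abs_neg,
        abs_one, one_div, inv_pow, inv_inv]
    have h4 : 1 + x ^ 2 ≤ 2 * |x| ^ 2 := by
      rw [← sq_abs x]
      nlinarith
    calc ‖x‖ ^ n * ‖φ x‖ * (1 + x ^ 2) ≤ |x| ^ n * ‖φ x‖ * (2 * |x| ^ 2) := by
          rw [Real.norm_eq_abs]; gcongr
      _ = 2 * (|x| ^ (n + 2) * ‖φ x‖) := by ring
      _ ≤ 2 * (|x| ^ (d + 1) * ‖φ x‖) := by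
          gcongr 2 * (?_ * _)
          exact pow_le_pow_right₀ hx.le (by omega)
      _ ≤ 2 * (A + B) := by rw [← h3]; linarith

theorem MemI.integrable_pow_mul {d n : ℕ} {φ : ℝ → ℂ} (h : MemI d φ) (hn : n < d) :
    Integrable fun x : ℝ => ‖x‖ ^ n * ‖φ x‖ := by
  obtain ⟨C, hC⟩ := h.exists_bound
  have hφ := h.1.continuous
  refine (integrable_inv_one_add_sq.const_mul C).mono'
    (show Continuous fun x : ℝ => ‖x‖ ^ n * ‖φ x‖ by fun_prop).aestronglyMeasurable
    (Filter.Eventually.of_forall fun x => ?_)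
  rw [Real.norm_of_nonneg (by positivity)]
  exact hC n hn x

theorem MemI.integrable {d : ℕ} (hd : 0 < d) {φ : ℝ → ℂ} (h : MemI d φ) : Integrable φ := by
  have := h.integrable_pow_mul hd
  simp only [pow_zero, one_mul] at this
  exact (integrable_norm_iff h.1.continuous.aestronglyMeasurable).1 this

theorem fourierHat_eq_fourier (φ : ℝ → ℂ) (y : ℝ) :
    fourierHat φ y = (((2 * Real.pi) ^ (-(1 : ℝ) / 2) : ℝ) : ℂ) *
      FourierTransform.fourier φ ((2 * Real.pi)⁻¹ * y) := by
  rw [fourierHat, Real.fourier_real_eq_integral_exp_smul]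
  congr 2 with x
  rw [smul_eq_mul, mul_comm]
  congr 2
  have : (Real.pi : ℂ) ≠ 0 := by exact_mod_cast Real.pi_ne_zero
  push_cast
  field_simp

theorem MemI.contDiff_fourierHat {d n : ℕ} {φ : ℝ → ℂ} (h : MemI d φ) (hn : n < d) :
    ContDiff ℝ n (fourierHat φ) := by
  rw [funext (fourierHat_eq_fourier φ)]
  have : ContDiff ℝ ((n : ℕ∞) : WithTop ℕ∞) (FourierTransform.fourier φ) :=
    Real.contDiff_fourier fun k hk =>
      h.integrable_pow_mul (lt_of_le_of_lt (by exact_mod_cast hk) hn)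
  exact contDiff_const.mul (this.comp (contDiff_const.mul contDiff_id))

theorem integrable_mul_exp_of_integrable {φ : ℝ → ℂ} (h : Integrable φ) (y : ℝ) :
    Integrable fun x : ℝ => φ x * Complex.exp (-(Complex.I * x * y)) := by
  refine h.mul_bdd (c := 1)
    (show Continuous fun x : ℝ => Complex.exp (-(Complex.I * x * y)) by
      fun_prop).aestronglyMeasurable (Filter.Eventually.of_forall fun x => ?_)
  rw [Complex.norm_exp]
  simp

theorem fourierHat_sub_const_mul {φ χ : ℝ → ℂ} (hφ : Integrable φ) (hχ : Integrable χ) (c : ℂ)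
    (y : ℝ) :
    fourierHat (fun x => φ x - c * χ x) y = fourierHat φ y - c * fourierHat χ y := by
  simp only [fourierHat, sub_mul, mul_assoc c]
  rw [integral_sub (integrable_mul_exp_of_integrable hφ y)
    ((integrable_mul_exp_of_integrable hχ y).const_mul c), integral_const_mul]
  ring

theorem fourierHat_comp_neg (φ : ℝ → ℂ) (y : ℝ) :
    fourierHat (fun x => φ (-x)) y = fourierHat φ (-y) := by
  rw [fourierHat, fourierHat, ← integral_neg_eq_self]
  simp

theorem integrableOn_pow_mul_exp_neg (m : ℕ) :
    IntegrableOn (fun t : ℝ => t ^ m * Real.exp (-t)) (Ioi 0) := by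
  have := Real.GammaIntegral_convergent (s := m + 1) (by positivity)
  simpa [mul_comm] using this

theorem norm_pow_mul_exp (m : ℕ) (θ : ℝ) {t : ℝ} (ht : 0 ≤ t) :
    ‖(t : ℂ) ^ m * Complex.exp (-(1 + Complex.I * θ) * t)‖ = t ^ m * Real.exp (-t) := by
  rw [norm_mul, norm_pow, Complex.norm_real, Real.norm_of_nonneg ht, Complex.norm_exp]
  simp

theorem integrableOn_pow_mul_cexp (m : ℕ) (θ : ℝ) :
    IntegrableOn (fun t : ℝ => (t : ℂ) ^ m * Complex.exp (-(1 + Complex.I * θ) * t)) (Ioi 0) := by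
  refine (integrableOn_pow_mul_exp_neg m).mono'
    (show Continuous fun t : ℝ => (t : ℂ) ^ m * Complex.exp (-(1 + Complex.I * θ) * t) by
      fun_prop).aestronglyMeasurable ?_
  filter_upwards [ae_restrict_mem measurableSet_Ioi] with t ht
  exact (norm_pow_mul_exp m θ (mem_Ioi.1 ht).le).le

theorem integral_pow_mul_cexp (m : ℕ) (θ : ℝ) :
    ∫ t in Ioi (0 : ℝ), (t : ℂ) ^ m * Complex.exp (-(1 + Complex.I * θ) * t) =
      m.factorial * ratPow m θ := by
  have hr := one_add_I_mul_ne_zero θ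
  induction m with
  | zero =>
    simp only [pow_zero, one_mul]
    rw [integral_exp_mul_complex_Ioi (by simp)]
    rw [neg_div_neg_eq]
    simp [ratPow]
  | succ m ih =>
    have hderiv : ∀ t : ℝ, HasDerivAt
        (fun t : ℝ => (t : ℂ) ^ (m + 1) * Complex.exp (-(1 + Complex.I * θ) * t))
        ((m + 1) * ((t : ℂ) ^ m * Complex.exp (-(1 + Complex.I * θ) * t)) -
          (1 + Complex.I * θ) *
            ((t : ℂ) ^ (m + 1) * Complex.exp (-(1 + Complex.I * θ) * t))) t := by
      intro t
      have h1 : HasDerivAt (fun z : ℂ => z ^ (m + 1) * Complex.exp (-(1 + Complex.I * θ) * z))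
          _ (t : ℂ) := (hasDerivAt_pow (m + 1) (t : ℂ)).mul
            (((hasDerivAt_id (t : ℂ)).const_mul (-(1 + Complex.I * θ))).cexp)
      refine h1.comp_ofReal.congr_deriv ?_
      simp
      ring
    have hlim : Filter.Tendsto
        (fun t : ℝ => (t : ℂ) ^ (m + 1) * Complex.exp (-(1 + Complex.I * θ) * t))
        Filter.atTop (nhds 0) := by
      rw [tendsto_zero_iff_norm_tendsto_zero]
      refine (Real.tendsto_pow_mul_exp_neg_atTop_nhds_zero (m + 1)).congr' ?_
      filter_upwards [Filter.eventually_ge_atTop 0] with t ht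
      exact (norm_pow_mul_exp (m + 1) θ ht).symm
    have h1 := (integrableOn_pow_mul_cexp m θ).const_mul ((m : ℂ) + 1)
    have h2 := (integrableOn_pow_mul_cexp (m + 1) θ).const_mul (1 + Complex.I * θ)
    have key := integral_Ioi_of_hasDerivAt_of_tendsto (hderiv 0).continuousAt.continuousWithinAt
      (fun t _ => hderiv t) (h1.sub h2) hlim
    rw [integral_sub h1 h2, integral_const_mul, integral_const_mul, ih] at key
    simp only [ratPow, Complex.ofReal_zero, zero_pow (Nat.succ_ne_zero m), zero_mul, sub_zero]
      at key ⊢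
    rw [sub_eq_zero] at key
    apply mul_left_cancel₀ hr
    rw [← key, Nat.factorial_succ, pow_succ _ (m + 1)]
    push_cast
    field_simp

/-- The one-sided function `t ↦ t^m e^{-t}` on `t > 0`, extended by `0`. -/
noncomputable def gammaDensity (m : ℕ) (t : ℝ) : ℂ := ((max t 0 ^ m * Real.exp (-t) : ℝ) : ℂ)

theorem gammaDensity_eq_indicator {m : ℕ} (hm : m ≠ 0) :
    gammaDensity m = (Ioi 0).indicator fun t : ℝ => ((t ^ m * Real.exp (-t) : ℝ) : ℂ) := by
  ext t
  by_cases ht : 0 < t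
  · rw [indicator_of_mem (mem_Ioi.2 ht), gammaDensity, max_eq_left ht.le]
  · rw [indicator_of_notMem (by simpa using ht), gammaDensity, max_eq_right (not_lt.1 ht),
      zero_pow hm]
    simp

theorem integrable_gammaDensity {m : ℕ} (hm : m ≠ 0) : Integrable (gammaDensity m) := by
  rw [gammaDensity_eq_indicator hm, integrable_indicator_iff measurableSet_Ioi]
  exact (integrableOn_pow_mul_exp_neg m).ofReal

theorem fourier_gammaDensity {m : ℕ} (hm : m ≠ 0) (w : ℝ) :
    FourierTransform.fourier (gammaDensity m) w = m.factorial * ratPow m (2 * Real.pi * w) := by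
  rw [Real.fourier_real_eq_integral_exp_smul, ← integral_pow_mul_cexp,
    ← integral_indicator measurableSet_Ioi, gammaDensity_eq_indicator hm]
  congr 1 with t
  by_cases ht : t ∈ Ioi (0 : ℝ)
  · rw [indicator_of_mem ht, indicator_of_mem ht, smul_eq_mul]
    push_cast
    rw [mul_left_comm, ← Complex.exp_add]
    congr 2
    ring
  · rw [indicator_of_notMem ht, indicator_of_notMem ht, smul_zero]

theorem integrable_fourier_gammaDensity {m : ℕ} (hm : m ≠ 0) :
    Integrable (FourierTransform.fourier (gammaDensity m)) := by
  rw [funext (fourier_gammaDensity hm)]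
  exact (((memI_ratPow m).integrable (Nat.pos_of_ne_zero hm)).comp_mul_left'
    Real.two_pi_pos.ne').const_mul _

theorem exists_fourierHat_ratPow {m : ℕ} (hm : m ≠ 0) :
    ∃ c : ℂ, ∀ y : ℝ, fourierHat (ratPow m) y = c * gammaDensity m (-y) := by
  have hcont : Continuous (gammaDensity m) := by
    unfold gammaDensity
    fun_prop
  have hinv := hcont.fourierInv_fourier_eq (integrable_gammaDensity hm)
    (integrable_fourier_gammaDensity hm)
  refine ⟨(((2 * Real.pi) ^ (-(1 : ℝ) / 2) : ℝ) : ℂ) * (2 * Real.pi) * (m.factorial : ℂ)⁻¹,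
    fun y => ?_⟩
  have hfac : (m.factorial : ℂ) ≠ 0 := by exact_mod_cast m.factorial_ne_zero
  have hpi : (Real.pi : ℂ) ≠ 0 := by exact_mod_cast Real.pi_ne_zero
  have hsub := Measure.integral_comp_mul_left
    (fun x : ℝ => ratPow m x * Complex.exp (-(Complex.I * x * y))) (2 * Real.pi)
  rw [← congrFun hinv (-y), Real.fourierInv_eq_fourier_neg, neg_neg,
    Real.fourier_real_eq_integral_exp_smul]
  have hint : ∫ v : ℝ, Complex.exp (((-2 * Real.pi * v * y : ℝ) : ℂ) * Complex.I) •
      FourierTransform.fourier (gammaDensity m) v = m.factorial *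
        ∫ v : ℝ, ratPow m (2 * Real.pi * v) *
          Complex.exp (-(Complex.I * ((2 * Real.pi * v : ℝ) : ℂ) * y)) := by
    rw [← integral_const_mul]
    congr 1 with v
    rw [fourier_gammaDensity hm, smul_eq_mul, mul_comm, mul_assoc]
    congr 3
    push_cast
    ring
  rw [hint, hsub, fourierHat, abs_of_pos (inv_pos.2 Real.two_pi_pos), Complex.real_smul]
  generalize (∫ x : ℝ, ratPow m x * Complex.exp (-(Complex.I * x * y))) = J
  push_cast
  field_simp

theorem MemI.exists_smooth_fourierHat {d : ℕ} (hd : 0 < d) {φ : ℝ → ℂ} (h : MemI d φ) :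
    ∃ g : ℝ → ℂ, ContDiff ℝ (⊤ : ℕ∞) g ∧ ∀ y, 0 < y → g y = fourierHat φ y := by
  choose c hc using fun (n : ℕ) (χ : {χ : ℝ → ℂ // MemI (d + n) χ}) => χ.2.exists_sub_ratPow
  let Φ : (n : ℕ) → {χ : ℝ → ℂ // MemI (d + n) χ} := fun n =>
    Nat.rec ⟨φ, h⟩ (fun n χ => ⟨_, hc n χ⟩) n
  choose b hb using fun n : ℕ => exists_fourierHat_ratPow (m := d + n) (by omega)
  have hsmooth : ∀ n : ℕ, ContDiff ℝ n fun y : ℝ => Complex.exp (-y) * fourierHat (Φ n).1 y :=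
    fun n => (Complex.contDiff_exp.comp Complex.ofRealCLM.contDiff.neg).mul
      ((Φ n).2.contDiff_fourierHat (by omega))
  have hstep : ∀ (n : ℕ) (y : ℝ), Complex.exp (-y) * fourierHat (Φ n).1 y =
      Complex.exp (-y) * fourierHat (Φ (n + 1)).1 y +
        c n (Φ n) * b n * ((max (-y) 0 ^ (d + n) : ℝ) : ℂ) := by
    intro n y
    have hsub : fourierHat (Φ (n + 1)).1 y = _ := fourierHat_sub_const_mul
      ((Φ n).2.integrable (by omega)) ((memI_ratPow (d + n)).integrable (by omega)) (c n (Φ n)) y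
    have hexp : Complex.exp (-y) * Complex.exp y = 1 := by
      rw [← Complex.exp_add, neg_add_cancel, Complex.exp_zero]
    rw [hsub, hb, gammaDensity, neg_neg]
    push_cast
    linear_combination (c n (Φ n) * b n * (max (-(y : ℝ)) 0 : ℝ) ^ (d + n)) * hexp
  obtain ⟨g, hg, hgy⟩ := exists_contDiff_of_truncated_pow hd _ _ hsmooth hstep
  refine ⟨fun y => Complex.exp y * g y,
    (Complex.contDiff_exp.comp Complex.ofRealCLM.contDiff).mul hg, fun y hy => ?_⟩
  beta_reduce
  rw [hgy y hy, ← mul_assoc, ← Complex.exp_add]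
  simp [Φ]

theorem abs_rpow_mul_Md (d : ℕ) (φ : ℝ → ℂ) {y : ℝ} (hy : y ≠ 0) :
    ((|y| ^ (((d : ℝ) - 1) / 2) : ℝ) : ℂ) * Md d φ y = fourierHat φ y := by
  rw [Md, ← mul_assoc, ← Complex.ofReal_mul, ← Real.rpow_add (abs_pos.2 hy)]
  ring_nf
  simp

/-- for `f ∈ S̃_d`, the function `y ↦ |y|^{(d-1)/2} f(y)` is smooth on the
right and on the left at `y = 0`: its restriction to `(0,∞)` extends to a smooth
function on `[0,∞)`, and its restriction to `(-∞,0)` extends to a smooth function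
on `(-∞,0]`. -/
theorem Stilde_one_sided_smooth (d : ℕ) (hd : 0 < d) (f : ℝ → ℂ) (hf : MemStilde d f) :
    (∃ g : ℝ → ℂ, ContDiff ℝ (⊤ : ℕ∞) g ∧
      ∀ y : ℝ, 0 < y → g y = ((|y| ^ (((d : ℝ) - 1) / 2) : ℝ) : ℂ) * f y) ∧
    ∃ h : ℝ → ℂ, ContDiff ℝ (⊤ : ℕ∞) h ∧
      ∀ y : ℝ, y < 0 → h y = ((|y| ^ (((d : ℝ) - 1) / 2) : ℝ) : ℂ) * f y := by
  obtain ⟨φ, hφ, hfφ⟩ := hf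
  constructor
  · obtain ⟨g, hg, hgy⟩ := hφ.exists_smooth_fourierHat hd
    exact ⟨g, hg, fun y hy => by rw [hfφ y hy.ne', abs_rpow_mul_Md d φ hy.ne', hgy y hy]⟩
  · obtain ⟨g, hg, hgy⟩ := hφ.comp_neg.exists_smooth_fourierHat hd
    exact ⟨fun y => g (-y), hg.comp contDiff_neg, fun y hy => by
      beta_reduce
      rw [hfφ y hy.ne, abs_rpow_mul_Md d φ hy.ne, hgy (-y) (neg_pos.2 hy), fourierHat_comp_neg,
        neg_neg]⟩
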